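/- There exists a compact set A in ℝ³ with the following properties: (1) A is the union of four sets, each the image of the rectangular box [0,4]×[0,2]×[0,1] under an isometry of ℝ³, and the interiors of these four boxes are pairwise disjoint; (2) there is an isometry r of ℝ³ such that A ∪ r(A) is the image of the box [0,8]×[0,4]×[0,2] under an isometry of ℝ³, and the interiors of A and r(A) are disjoint; (3) the interior of A is connected but not simply connected; (4) A is an 8-rep-tile: there exist isometries h₁, …, h₈ of ℝ³ with 2•A = h₁(A) ∪ … ∪ h₈(A) and the interiors of h₁(A), …, h₈(A) pairwise disjoint. -/

import Mathlib

open Pointwise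

/-- The rectangular box `[0,a] × [0,b] × [0,c]` in ℝ³. -/
def Box (a b c : ℝ) : Set (EuclideanSpace ℝ (Fin 3)) :=
  {x | x 0 ∈ Set.Icc 0 a ∧ x 1 ∈ Set.Icc 0 b ∧ x 2 ∈ Set.Icc 0 c}

section

open Set

lemma IsometryEquiv.image_interior {X Y : Type*} [PseudoEMetricSpace X] [PseudoEMetricSpace Y]
    (e : X ≃ᵢ Y) (s : Set X) : e '' interior s = interior (e '' s) :=
  e.toHomeomorph.image_interior s

lemma IsometryEquiv.refl_image {X : Type*} [PseudoEMetricSpace X] (s : Set X) :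
    IsometryEquiv.refl X '' s = s :=
  image_id s

section RepTile

variable {E : Type*} [NormedAddCommGroup E] [NormedSpace ℝ E]

/-- The conjugate of an isometry by the homothety of ratio `c ≠ 0`. -/
noncomputable def IsometryEquiv.conjSMul (c : ℝ) (hc : c ≠ 0) (e : E ≃ᵢ E) : E ≃ᵢ E :=
  IsometryEquiv.mk' (fun x => c • e (c⁻¹ • x)) (fun x => c • e.symm (c⁻¹ • x))
    (fun x => by simp [smul_smul, hc])
    (Isometry.of_dist_eq fun x y => by
      rw [dist_smul₀, e.dist_eq, dist_smul₀, ← mul_assoc, ← norm_mul, mul_inv_cancel₀ hc]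
      simp)

lemma IsometryEquiv.conjSMul_apply (c : ℝ) (hc : c ≠ 0) (e : E ≃ᵢ E) (x : E) :
    e.conjSMul c hc x = c • e (c⁻¹ • x) := rfl

lemma IsometryEquiv.conjSMul_image_smul (c : ℝ) (hc : c ≠ 0) (e : E ≃ᵢ E) (P : Set E) :
    e.conjSMul c hc '' (c • P) = c • (e '' P) := by
  simp only [← image_smul, image_image]
  refine image_congr fun x _ => ?_
  simp [IsometryEquiv.conjSMul_apply, smul_smul, hc]

/-- If `A` is tiled by `m` copies of `P` and `c • P` is tiled by `n` copies of `A`, then `A` is an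
`m * n`-rep-tile with expansion factor `c`. -/
lemma exists_repTile_of_tilings {m n : ℕ} {A P : Set E} {c : ℝ} (hc : c ≠ 0)
    (e : Fin m → E ≃ᵢ E) (s : Fin n → E ≃ᵢ E)
    (hA : A = ⋃ i, e i '' P)
    (he : Pairwise fun i j => Disjoint (interior (e i '' P)) (interior (e j '' P)))
    (hP : c • P = ⋃ i, s i '' A)
    (hs : Pairwise fun i j => Disjoint (interior (s i '' A)) (interior (s j '' A))) :
    ∃ h : Fin (m * n) → E ≃ᵢ E, c • A = ⋃ k, h k '' A ∧
      Pairwise fun k l => Disjoint (interior (h k '' A)) (interior (h l '' A)) := by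
  let g : Fin m × Fin n → E ≃ᵢ E := fun p => (s p.2).trans ((e p.1).conjSMul c hc)
  have hg (p) : g p '' A = (e p.1).conjSMul c hc '' (s p.2 '' A) := by
    rw [← image_comp]; rfl
  refine ⟨fun k => g (finProdFinEquiv.symm k), ?_, ?_⟩
  · rw [finProdFinEquiv.symm.surjective.iUnion_comp (fun p => g p '' A), iUnion_prod']
    simp_rw [hg, ← image_iUnion, ← hP, IsometryEquiv.conjSMul_image_smul]
    conv_lhs => rw [hA, smul_set_iUnion]
  · suffices Pairwise fun p q => Disjoint (interior (g p '' A)) (interior (g q '' A)) from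
      fun k l hkl => this (finProdFinEquiv.symm.injective.ne hkl)
    rintro ⟨i, a⟩ ⟨j, b⟩ hne
    simp only [hg]
    by_cases hij : i = j
    · subst hij
      have hab : a ≠ b := fun h => hne (by rw [h])
      rw [← IsometryEquiv.image_interior _ (s a '' A), ← IsometryEquiv.image_interior _ (s b '' A),
        disjoint_image_iff (IsometryEquiv.injective _)]
      exact hs hab
    · have sub (i : Fin m) (a : Fin n) :
          interior ((e i).conjSMul c hc '' (s a '' A)) ⊆ c • interior (e i '' P) := by
        rw [← interior_smul₀ hc, ← IsometryEquiv.conjSMul_image_smul c hc, hP]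
        exact interior_mono (image_mono (subset_iUnion (fun b => s b '' A) a))
      refine Disjoint.mono (sub i a) (sub j b) ?_
      simp only [← image_smul]
      exact (disjoint_image_iff (smul_right_injective E hc)).2 (he hij)

end RepTile

lemma Disjoint.interior_closure {X : Type*} [TopologicalSpace X] {U V : Set X}
    (h : Disjoint U V) (hV : IsOpen V) :
    Disjoint (interior (closure U)) (interior (closure V)) := by
  have h₁ : Disjoint (interior (closure U)) V := (h.closure_left hV).mono_left interior_subset
  exact (h₁.closure_right isOpen_interior).mono_right interior_subset

section Boxes

variable {ι : Type*}

/-- The closed coordinate box with opposite corners `a` and `b`. -/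
def closedBox (a b : ι → ℝ) : Set (EuclideanSpace ℝ ι) := {x | ∀ i, x i ∈ Icc (a i) (b i)}

/-- The open coordinate box with opposite corners `a` and `b`. -/
def openBox (a b : ι → ℝ) : Set (EuclideanSpace ℝ ι) := {x | ∀ i, x i ∈ Ioo (a i) (b i)}

lemma isOpen_openBox [Finite ι] (a b : ι → ℝ) : IsOpen (openBox a b) := by
  simp only [openBox, ofPred_forall]
  exact isOpen_iInter_of_finite fun i => isOpen_Ioo.preimage (by fun_prop)

lemma convex_openBox (a b : ι → ℝ) : Convex ℝ (openBox a b) := by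
  simp only [openBox, ofPred_forall]
  exact convex_iInter fun i =>
    (convex_Ioo (a i) (b i)).linear_preimage (EuclideanSpace.proj (𝕜 := ℝ) i).toLinearMap

lemma closure_openBox [Fintype ι] {a b : ι → ℝ} (h : ∀ i, a i < b i) :
    closure (openBox a b) = closedBox a b := by
  let φ := (EuclideanSpace.equiv ι ℝ).toHomeomorph
  have h₁ : openBox a b = φ ⁻¹' (univ.pi fun i => Ioo (a i) (b i)) := by
    ext x; simp [openBox, φ]
  have h₂ : closedBox a b = φ ⁻¹' (univ.pi fun i => Icc (a i) (b i)) := by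
    ext x; simp [closedBox, φ, Pi.le_def, forall_and]
  rw [h₁, h₂, ← φ.preimage_closure, closure_pi_set]
  simp only [closure_Ioo (h _).ne]

lemma isCompact_closedBox [Fintype ι] (a b : ι → ℝ) : IsCompact (closedBox a b) := by
  let φ := (EuclideanSpace.equiv ι ℝ).toHomeomorph
  have h₂ : closedBox a b = φ ⁻¹' (univ.pi fun i => Icc (a i) (b i)) := by
    ext x; simp [closedBox, φ, Pi.le_def, forall_and]
  rw [h₂, φ.isCompact_preimage]
  exact isCompact_univ_pi fun _ => isCompact_Icc

end Boxes

/-- A set in which a map to `ℂ \ {0}` sends some loop to a circle around the origin is not simply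
connected. -/
lemma not_simplyConnectedSpace_of_winding {X : Type*} [TopologicalSpace X]
    [LocallyPathConnectedSpace X] (f : C(X, {z : ℂ // z ≠ 0})) (γ : ℝ → X) (hγ : Continuous γ)
    (hper : γ (2 * Real.pi) = γ 0) (c : ℂ)
    (hf : ∀ t : ℝ, (f (γ t) : ℂ) = c * Complex.exp (t * Complex.I)) :
    ¬ SimplyConnectedSpace X := by
  intro _
  obtain ⟨w, hw⟩ : ∃ w : ℂ, (⟨_, w.exp_ne_zero⟩ : {z : ℂ // z ≠ 0}) = f (γ 0) :=
    ⟨Complex.log (f (γ 0)), Subtype.ext (Complex.exp_log (f (γ 0)).2)⟩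
  obtain ⟨L, ⟨hL₀, hL⟩, -⟩ :=
    Complex.isCoveringMap_exp.existsUnique_continuousMap_lifts f (γ 0) w hw
  have key : (fun t : ℝ => L (γ t)) = fun t : ℝ => w + t * Complex.I := by
    refine Complex.isCoveringMap_exp.eq_of_comp_eq (by fun_prop) (by fun_prop) ?_ 0 (by simp [hL₀])
    funext t
    have h₁ := congrFun hL (γ t)
    have hw' := congrArg Subtype.val hw
    simp only [Function.comp_apply] at h₁ ⊢
    have h₀ := hf 0
    simp only [Complex.ofReal_zero, zero_mul, Complex.exp_zero, mul_one] at h₀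
    rw [h₁]
    refine Subtype.ext ((hf t).trans ?_)
    simp only [Complex.exp_add]
    rw [← h₀, ← hw']
  have h₁ := congrFun key (2 * Real.pi)
  have h₂ := congrFun key 0
  simp only [hper] at h₁ h₂
  rw [h₂] at h₁
  simp [Real.pi_ne_zero] at h₁

/-- The lower corners of the four plates of the ring-shaped tile. -/
def plateLo : Fin 4 → Fin 3 → ℝ := ![![0, 0, 0], ![6, 0, 0], ![2, 0, 0], ![2, 2, 0]]

/-- The upper corners of the four plates of the ring-shaped tile. -/
def plateHi : Fin 4 → Fin 3 → ℝ := ![![2, 4, 1], ![8, 4, 1], ![6, 1, 2], ![6, 3, 2]]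

/-- The tile with a hole: two flat plates joined by two upright ones. -/
def ringTile : Set (EuclideanSpace ℝ (Fin 3)) := ⋃ i, closedBox (plateLo i) (plateHi i)

/-- The union of the open plates of the tile. -/
def openPlates : Set (EuclideanSpace ℝ (Fin 3)) := ⋃ i, openBox (plateLo i) (plateHi i)

lemma plateLo_lt_plateHi (i : Fin 4) (j : Fin 3) : plateLo i j < plateHi i j := by
  fin_cases i <;> fin_cases j <;> norm_num [plateLo, plateHi]

lemma closure_openPlates : closure openPlates = ringTile := by
  simp only [openPlates, ringTile, closure_iUnion_of_finite,
    closure_openBox (plateLo_lt_plateHi _)]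

lemma isOpen_openPlates : IsOpen openPlates :=
  isOpen_iUnion fun _ => isOpen_openBox _ _

lemma mem_ringTile {x : EuclideanSpace ℝ (Fin 3)} :
    x ∈ ringTile ↔
      ((0 ≤ x 0 ∧ x 0 ≤ 2) ∧ (0 ≤ x 1 ∧ x 1 ≤ 4) ∧ 0 ≤ x 2 ∧ x 2 ≤ 1) ∨
      ((6 ≤ x 0 ∧ x 0 ≤ 8) ∧ (0 ≤ x 1 ∧ x 1 ≤ 4) ∧ 0 ≤ x 2 ∧ x 2 ≤ 1) ∨
      ((2 ≤ x 0 ∧ x 0 ≤ 6) ∧ (0 ≤ x 1 ∧ x 1 ≤ 1) ∧ 0 ≤ x 2 ∧ x 2 ≤ 2) ∨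
      ((2 ≤ x 0 ∧ x 0 ≤ 6) ∧ (2 ≤ x 1 ∧ x 1 ≤ 3) ∧ 0 ≤ x 2 ∧ x 2 ≤ 2) := by
  simp [ringTile, closedBox, plateLo, plateHi, Fin.exists_fin_succ, Fin.forall_fin_succ]

lemma mem_openPlates {x : EuclideanSpace ℝ (Fin 3)} :
    x ∈ openPlates ↔
      ((0 < x 0 ∧ x 0 < 2) ∧ (0 < x 1 ∧ x 1 < 4) ∧ 0 < x 2 ∧ x 2 < 1) ∨
      ((6 < x 0 ∧ x 0 < 8) ∧ (0 < x 1 ∧ x 1 < 4) ∧ 0 < x 2 ∧ x 2 < 1) ∨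
      ((2 < x 0 ∧ x 0 < 6) ∧ (0 < x 1 ∧ x 1 < 1) ∧ 0 < x 2 ∧ x 2 < 2) ∨
      ((2 < x 0 ∧ x 0 < 6) ∧ (2 < x 1 ∧ x 1 < 3) ∧ 0 < x 2 ∧ x 2 < 2) := by
  simp [openPlates, openBox, plateLo, plateHi, Fin.exists_fin_succ, Fin.forall_fin_succ]

lemma isCompact_ringTile : IsCompact ringTile :=
  isCompact_iUnion fun _ => isCompact_closedBox _ _

/-- The isometries placing the four plates. -/
noncomputable def plateIsometry (i : Fin 4) :
    EuclideanSpace ℝ (Fin 3) ≃ᵢ EuclideanSpace ℝ (Fin 3) :=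
  (LinearIsometryEquiv.piLpCongrLeft 2 ℝ ℝ
    (![Equiv.swap 0 1, Equiv.swap 0 1, Equiv.swap 1 2, Equiv.swap 1 2] i)).toIsometryEquiv.trans
    (IsometryEquiv.addRight (WithLp.toLp 2 (plateLo i)))

lemma plateIsometry_image (i : Fin 4) :
    plateIsometry i '' Box 4 2 1 = closedBox (plateLo i) (plateHi i) := by
  ext x
  rw [← IsometryEquiv.preimage_symm]
  have h01 : Equiv.swap (0 : Fin 3) 1 2 = 2 := by decide
  have h12 : Equiv.swap (1 : Fin 3) 2 0 = 0 := by decide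
  fin_cases i <;>
    simp [plateIsometry, closedBox, Box, plateLo, plateHi, Fin.forall_fin_succ,
      LinearIsometryEquiv.piLpCongrLeft_symm, LinearIsometryEquiv.piLpCongrLeft_apply,
      IsometryEquiv.symm_trans_apply, Equiv.piCongrLeft', h01, h12] <;>
    grind

lemma disjoint_openBox_plates {i j : Fin 4} (h : i ≠ j) :
    Disjoint (openBox (plateLo i) (plateHi i)) (openBox (plateLo j) (plateHi j)) := by
  rw [Set.disjoint_left]
  intro x hx hy
  fin_cases i <;> fin_cases j <;>
    simp [openBox, plateLo, plateHi, Fin.forall_fin_succ] at h hx hy <;> linarith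

lemma pairwise_disjoint_interior_plates :
    Pairwise fun i j => Disjoint (interior (plateIsometry i '' Box 4 2 1))
      (interior (plateIsometry j '' Box 4 2 1)) := by
  intro i j h
  simp only [plateIsometry_image, ← closure_openBox (plateLo_lt_plateHi _)]
  exact (disjoint_openBox_plates h).interior_closure (isOpen_openBox _ _)

/-- The point reflection in the centre of the box `8 × 4 × 2`. Since the tile is symmetric in the
first coordinate, its image is also the image under a rotation by 180 degrees. -/
noncomputable def centralReflection : EuclideanSpace ℝ (Fin 3) ≃ᵢ EuclideanSpace ℝ (Fin 3) :=
  IsometryEquiv.subLeft !₂[8, 4, 2]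

lemma mem_centralReflection_image {s : Set (EuclideanSpace ℝ (Fin 3))}
    {x : EuclideanSpace ℝ (Fin 3)} : x ∈ centralReflection '' s ↔ !₂[8, 4, 2] - x ∈ s := by
  constructor
  · rintro ⟨y, hy, rfl⟩
    simpa [centralReflection] using hy
  · exact fun h => ⟨_, h, by simp [centralReflection]⟩

lemma ringTile_union_centralReflection :
    ringTile ∪ centralReflection '' ringTile = Box 8 4 2 := by
  ext x
  simp only [mem_union, mem_centralReflection_image, mem_ringTile, Box, mem_ofPred_eq, mem_Icc]
  simp
  constructor
  · grind
  · grind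

lemma disjoint_interior_ringTile_centralReflection :
    Disjoint (interior ringTile) (interior (centralReflection '' ringTile)) := by
  have h : centralReflection '' ringTile = closure (centralReflection '' openPlates) := by
    rw [← closure_openPlates]
    exact centralReflection.toHomeomorph.image_closure _
  rw [h, ← closure_openPlates]
  refine Disjoint.interior_closure ?_
    (centralReflection.toHomeomorph.isOpenMap _ isOpen_openPlates)
  rw [disjoint_left]
  intro x hx hy
  rw [mem_centralReflection_image, mem_openPlates] at hy
  rw [mem_openPlates] at hx
  simp at hy
  grind

lemma smul_box : (2 : ℝ) • Box 4 2 1 = Box 8 4 2 := by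
  ext x
  rw [mem_smul_set_iff_inv_smul_mem₀ two_ne_zero]
  simp [Box]
  grind

/-- Six overlapping open boxes covering the open plates of the tile. -/
def ringCore : Set (EuclideanSpace ℝ (Fin 3)) :=
  (openBox ![0, 0, 0] ![8, 1, 1] ∪ openBox ![0, 0, 0] ![2, 4, 1] ∪ openBox ![6, 0, 0] ![8, 4, 1]) ∪
    openBox ![0, 2, 0] ![8, 3, 1] ∪ openBox ![2, 0, 0] ![6, 1, 2] ∪ openBox ![2, 2, 0] ![6, 3, 2]

lemma mem_ringCore {x : EuclideanSpace ℝ (Fin 3)} :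
    x ∈ ringCore ↔
      (((((((0 < x 0 ∧ x 0 < 8) ∧ (0 < x 1 ∧ x 1 < 1) ∧ 0 < x 2 ∧ x 2 < 1) ∨
      ((0 < x 0 ∧ x 0 < 2) ∧ (0 < x 1 ∧ x 1 < 4) ∧ 0 < x 2 ∧ x 2 < 1)) ∨
      ((6 < x 0 ∧ x 0 < 8) ∧ (0 < x 1 ∧ x 1 < 4) ∧ 0 < x 2 ∧ x 2 < 1)) ∨
      ((0 < x 0 ∧ x 0 < 8) ∧ (2 < x 1 ∧ x 1 < 3) ∧ 0 < x 2 ∧ x 2 < 1)) ∨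
      ((2 < x 0 ∧ x 0 < 6) ∧ (0 < x 1 ∧ x 1 < 1) ∧ 0 < x 2 ∧ x 2 < 2)) ∨
      ((2 < x 0 ∧ x 0 < 6) ∧ (2 < x 1 ∧ x 1 < 3) ∧ 0 < x 2 ∧ x 2 < 2)) := by
  simp [ringCore, openBox, Fin.forall_fin_succ]

lemma isOpen_ringCore : IsOpen ringCore := by
  unfold ringCore
  exact (((((isOpen_openBox _ _).union (isOpen_openBox _ _)).union (isOpen_openBox _ _)).union
    (isOpen_openBox _ _)).union (isOpen_openBox _ _)).union (isOpen_openBox _ _)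

lemma ringCore_subset_interior : ringCore ⊆ interior ringTile := by
  refine isOpen_ringCore.subset_interior_iff.2 fun x hx => ?_
  rw [mem_ringCore] at hx
  rw [mem_ringTile]
  grind

lemma openPlates_subset_ringCore : openPlates ⊆ ringCore := by
  intro x hx
  rw [mem_openPlates] at hx
  rw [mem_ringCore]
  grind

lemma isConnected_ringCore : IsConnected ringCore := by
  have box (a b : Fin 3 → ℝ) : IsPreconnected (openBox a b) := (convex_openBox a b).isPreconnected
  refine ⟨⟨!₂[1, 1 / 2, 1 / 2], ?_⟩, ?_⟩
  · rw [mem_ringCore]; simp; norm_num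
  have h₁ := (box ![0, 0, 0] ![8, 1, 1]).union !₂[1, 1 / 2, 1 / 2]
    (by simp [openBox, Fin.forall_fin_succ]; norm_num) (by simp [openBox, Fin.forall_fin_succ]; norm_num)
    (box ![0, 0, 0] ![2, 4, 1])
  have h₂ := h₁.union !₂[7, 1 / 2, 1 / 2]
    (by simp [openBox, Fin.forall_fin_succ]; norm_num) (by simp [openBox, Fin.forall_fin_succ]; norm_num)
    (box ![6, 0, 0] ![8, 4, 1])
  have h₃ := h₂.union !₂[1, 5 / 2, 1 / 2]
    (by simp [openBox, Fin.forall_fin_succ]; norm_num) (by simp [openBox, Fin.forall_fin_succ]; norm_num)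
    (box ![0, 2, 0] ![8, 3, 1])
  have h₄ := h₃.union !₂[3, 1 / 2, 1 / 2]
    (by simp [openBox, Fin.forall_fin_succ]; norm_num) (by simp [openBox, Fin.forall_fin_succ]; norm_num)
    (box ![2, 0, 0] ![6, 1, 2])
  exact h₄.union !₂[3, 5 / 2, 1 / 2]
    (by simp [openBox, Fin.forall_fin_succ]; norm_num) (by simp [openBox, Fin.forall_fin_succ]; norm_num)
    (box ![2, 2, 0] ![6, 3, 2])

lemma isConnected_interior_ringTile : IsConnected (interior ringTile) := by
  refine isConnected_ringCore.subset_closure ringCore_subset_interior ?_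
  refine interior_subset.trans ?_
  rw [← closure_openPlates]
  exact closure_mono openPlates_subset_ringCore

/-- The projection of the tile along its hole, rescaled so that the hole is a unit square centred
at the origin. -/
noncomputable def holeProjection (x : EuclideanSpace ℝ (Fin 3)) : ℂ :=
  ((x 0 - 4) / 4 : ℝ) + (x 1 - 3 / 2 : ℝ) * Complex.I

lemma holeProjection_ne_zero {x : EuclideanSpace ℝ (Fin 3)} (hx : x ∈ ringTile) :
    holeProjection x ≠ 0 := by
  intro h
  have h₀ := congrArg Complex.re h
  have h₁ := congrArg Complex.im h
  simp [holeProjection] at h₀ h₁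
  rw [mem_ringTile] at hx
  grind

/-- An ellipse around the hole of the tile. -/
noncomputable def holeLoop (t : ℝ) : EuclideanSpace ℝ (Fin 3) :=
  !₂[4 + 16 / 5 * Real.cos t, 3 / 2 + 4 / 5 * Real.sin t, 1 / 2]

lemma holeLoop_mem (t : ℝ) : holeLoop t ∈ ringCore := by
  rw [mem_ringCore]
  simp only [holeLoop]
  have h := Real.sin_sq_add_cos_sq t
  have hc := Real.cos_le_one t
  have hc' := Real.neg_one_le_cos t
  have hs := Real.sin_le_one t
  have hs' := Real.neg_one_le_sin t
  generalize Real.cos t = c at *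
  generalize Real.sin t = s at *
  simp
  by_cases h₁ : 5 / 8 < c
  · grind
  by_cases h₂ : c < -5 / 8
  · grind
  have hc2 : c ^ 2 ≤ 25 / 64 := by nlinarith
  by_cases h₃ : 0 ≤ s
  · have : 5 / 8 < s := by nlinarith
    grind
  · have : s < -5 / 8 := by nlinarith
    grind

lemma not_simplyConnectedSpace_interior_ringTile :
    ¬ SimplyConnectedSpace (interior ringTile) := by
  have : LocallyPathConnectedSpace (interior ringTile) :=
    isOpen_interior.locallyPathConnectedSpace
  refine not_simplyConnectedSpace_of_winding
    ⟨fun x => ⟨holeProjection x, holeProjection_ne_zero (interior_subset x.2)⟩, ?_⟩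
    (fun t => ⟨holeLoop t, ringCore_subset_interior (holeLoop_mem t)⟩) ?_ ?_ (4 / 5) ?_
  · unfold holeProjection
    fun_prop
  · unfold holeLoop
    fun_prop
  · simp [holeLoop]
  · intro t
    simp [holeProjection, holeLoop, Complex.exp_mul_I]
    ring

end

/-- There is a compact set `A ⊆ ℝ³` which is a union of four isometric copies of the
`4 × 2 × 1` box with pairwise disjoint interiors, such that `A` together with a rotated
copy of itself forms an `8 × 4 × 2` box, the interior of `A` is connected but not simply
connected, and `A` is an 8-rep-tile with expansion factor 2. -/
theorem exists_simplified_rep_tile_with_hole :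
    ∃ A : Set (EuclideanSpace ℝ (Fin 3)),
      IsCompact A ∧
      -- (1) A is the union of four isometric copies of the 4×2×1 box,
      --     with pairwise disjoint interiors
      (∃ e : Fin 4 → (EuclideanSpace ℝ (Fin 3) ≃ᵢ EuclideanSpace ℝ (Fin 3)),
        A = ⋃ i, e i '' Box 4 2 1 ∧
        Pairwise fun i j =>
          Disjoint (interior (e i '' Box 4 2 1)) (interior (e j '' Box 4 2 1))) ∧
      -- (2) A and an isometric copy of A together form an 8×4×2 box
      (∃ r t : EuclideanSpace ℝ (Fin 3) ≃ᵢ EuclideanSpace ℝ (Fin 3),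
        A ∪ r '' A = t '' Box 8 4 2 ∧
        Disjoint (interior A) (interior (r '' A))) ∧
      -- (3) the interior of A is connected but not simply connected
      IsConnected (interior A) ∧ ¬ SimplyConnectedSpace (interior A) ∧
      -- (4) A is an 8-rep-tile
      (∃ h : Fin 8 → (EuclideanSpace ℝ (Fin 3) ≃ᵢ EuclideanSpace ℝ (Fin 3)),
        (2 : ℝ) • A = ⋃ i, h i '' A ∧
        Pairwise fun i j => Disjoint (interior (h i '' A)) (interior (h j '' A))) := by
  refine ⟨ringTile, isCompact_ringTile, ⟨plateIsometry, ?_, ?_⟩,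
    ⟨centralReflection, IsometryEquiv.refl _, ?_, disjoint_interior_ringTile_centralReflection⟩,
    isConnected_interior_ringTile, not_simplyConnectedSpace_interior_ringTile,
    exists_repTile_of_tilings (m := 4) (n := 2) (P := Box 4 2 1) two_ne_zero plateIsometry
      ![IsometryEquiv.refl _, centralReflection] ?_ ?_ ?_ ?_⟩
  · simp only [plateIsometry_image, ringTile]
  · exact pairwise_disjoint_interior_plates
  · rw [IsometryEquiv.refl_image, ringTile_union_centralReflection]
  · simp only [plateIsometry_image, ringTile]
  · exact pairwise_disjoint_interior_plates
  · rw [smul_box, ← ringTile_union_centralReflection]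
    ext x
    rw [Set.mem_iUnion, Fin.exists_fin_two]
    simp only [Matrix.cons_val_zero, Matrix.cons_val_one, IsometryEquiv.refl_image, Set.mem_union]
  · have h₀ := disjoint_interior_ringTile_centralReflection
    intro i j h
    fin_cases i <;> fin_cases j
    · exact absurd rfl h
    · exact (IsometryEquiv.refl_image ringTile).symm ▸ h₀
    · exact (IsometryEquiv.refl_image ringTile).symm ▸ h₀.symm
    · exact absurd rfl h
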